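/- For every real p with 0 < p < 1/2, the mass problem B(p) is Medvedev equivalent to the mass problem AED(h) for the function h(n) = 2^(2^n); that is, B(p) ≤_S AED(2^(2^n)) and AED(2^(2^n)) ≤_S B(p). -/

import Mathlib

open Filter

namespace Paper

/-! ### Oracle computability -/

/-- Codes for oracle Turing functionals (partial recursive operators with one
function oracle), following the pattern of `Nat.Partrec.Code`. -/
inductive OracleCode : Type
  | zero
  | succ
  | left
  | right
  | oracle
  | pair : OracleCode → OracleCode → OracleCode
  | comp : OracleCode → OracleCode → OracleCode
  | prec : OracleCode → OracleCode → OracleCode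
  | rfind' : OracleCode → OracleCode

/-- Evaluation of an oracle code with oracle `g : ℕ → ℕ`. -/
def OracleCode.eval (g : ℕ → ℕ) : OracleCode → ℕ →. ℕ
  | .zero => pure 0
  | .succ => Nat.succ
  | .left => ↑fun n : ℕ => n.unpair.1
  | .right => ↑fun n : ℕ => n.unpair.2
  | .oracle => ↑fun n : ℕ => g n
  | .pair cf cg => fun n => Nat.pair <$> eval g cf n <*> eval g cg n
  | .comp cf cg => fun n => eval g cg n >>= eval g cf
  | .prec cf cg =>
    Nat.unpaired fun a n =>
      n.rec (eval g cf a) fun y IH => do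
        let i ← IH
        eval g cg (Nat.pair a (Nat.pair y i))
  | .rfind' cf =>
    Nat.unpaired fun a m =>
      (Nat.rfind fun n => (fun m => m = 0) <$> eval g cf (Nat.pair a (n + m))).map (· + m)

/-- Turing reducibility: `f ≤_T g` iff some oracle functional with oracle `g`
computes `f` (totally). -/
def TuringLE (f g : ℕ → ℕ) : Prop :=
  ∃ c : OracleCode, ∀ n, OracleCode.eval g c n = Part.some (f n)

/-- Turing equivalence. -/
def TuringEquiv (f g : ℕ → ℕ) : Prop := TuringLE f g ∧ TuringLE g f

/-- A mass problem is a set of functions `ℕ → ℕ`. -/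
abbrev MassProblem := Set (ℕ → ℕ)

/-- Muchnik (weak) reducibility `B ≤_W C`. -/
def MuchnikLE (B C : MassProblem) : Prop := ∀ g ∈ C, ∃ f ∈ B, TuringLE f g

/-- Muchnik equivalence. -/
def MuchnikEquiv (B C : MassProblem) : Prop := MuchnikLE B C ∧ MuchnikLE C B

/-- Medvedev (strong) reducibility `B ≤_S C`: a single Turing functional is
defined on all of `C` and maps each member of `C` to a member of `B`. -/
def MedvedevLE (B C : MassProblem) : Prop :=
  ∃ c : OracleCode, ∀ g ∈ C, ∃ f ∈ B, ∀ n, OracleCode.eval g c n = Part.some (f n)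

/-- Medvedev equivalence. -/
def MedvedevEquiv (B C : MassProblem) : Prop := MedvedevLE B C ∧ MedvedevLE C B

/-! ### Density notions -/

/-- Lower (asymptotic) density of a set of naturals. -/
noncomputable def lowerDensity (z : Set ℕ) : ℝ :=
  Filter.liminf (fun n => (Nat.card ↥(z ∩ Set.Iio n) : ℝ) / n) Filter.atTop

/-- `x ↔ y`: the agreement set of two functions. -/
def agree (x y : ℕ → ℕ) : Set ℕ := {n | x n = y n}

/-- A bit sequence is a `{0,1}`-valued function. -/
def IsBitSeq (x : ℕ → ℕ) : Prop := ∀ n, x n < 2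

/-- The mass problem `D(p)`. -/
def probD (p : ℝ) : MassProblem :=
  {y | IsBitSeq y ∧ ∀ x : ℕ → ℕ, IsBitSeq x → Computable x →
    lowerDensity (agree x y) ≤ p}

/-- The mass problem `B(p)`. -/
def probB (p : ℝ) : MassProblem :=
  {y | IsBitSeq y ∧ ∀ x : ℕ → ℕ, IsBitSeq x → Computable x →
    p < lowerDensity (agree x y)}

/-- The mass problem `IOE(h)`. -/
def IOE (h : ℕ → ℕ) : MassProblem :=
  {f | ∀ x : ℕ → ℕ, Computable x → (∀ n, x n < h n) → ∃ᶠ n in atTop, f n = x n}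

/-- The mass problem `AED(h)`. -/
def AED (h : ℕ → ℕ) : MassProblem :=
  {f | (∀ n, f n < h n) ∧ ∀ x : ℕ → ℕ, Computable x → ∀ᶠ n in atTop, f n ≠ x n}

/-! ### Hamming distance and the problems `D⟨≠*,ĥ,q⟩`, `B⟨≠*,ĥ,q⟩` -/

/-- Normalized Hamming distance between `a` and `b`, viewed as binary strings
of length `r` (via binary expansion with leading zeros). -/
noncomputable def nhd (r a b : ℕ) : ℝ :=
  (((Finset.range r).filter fun i => a.testBit i ≠ b.testBit i).card : ℝ) / r

/-- The mass problem `D⟨≠*, ĥ, q⟩`. -/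
def probDneq (hh : ℕ → ℕ) (q : ℝ) : MassProblem :=
  {y | (∀ n, y n < 2 ^ hh n) ∧ ∀ x : ℕ → ℕ, Computable x → (∀ n, x n < 2 ^ hh n) →
    ∃ᶠ n in atTop, nhd (hh n) (x n) (y n) < q}

/-- The mass problem `B⟨≠*, ĥ, q⟩`. -/
def probBneq (hh : ℕ → ℕ) (q : ℝ) : MassProblem :=
  {y | (∀ n, y n < 2 ^ hh n) ∧ ∀ x : ℕ → ℕ, Computable x → (∀ n, x n < 2 ^ hh n) →
    ∀ᶠ n in atTop, q ≤ nhd (hh n) (x n) (y n)}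

/-! ### Slaloms, coded as functions `ℕ → ℕ` via binary digits -/

/-- `s : ℕ → ℕ`, coding finite sets via binary digits (`i ∈ s(n)` iff the
`i`-th bit of `s n` is set), is an `L`-slalom bounded by `u`. -/
def IsSlalomCode (u : ℕ → ℕ) (L : ℕ) (s : ℕ → ℕ) : Prop :=
  ∀ n, (∀ i, (s n).testBit i = true → i < u n) ∧
    ((Finset.range (u n)).filter fun i => (s n).testBit i = true).card ≤ L

/-- The mass problem `D⟨∌*, u, L⟩`. -/
def probDSlalom (u : ℕ → ℕ) (L : ℕ) : MassProblem :=
  {s | IsSlalomCode u L s ∧ ∀ y : ℕ → ℕ, Computable y → (∀ n, y n < u n) →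
    ∃ᶠ n in atTop, (s n).testBit (y n) = true}

/-- The mass problem `B⟨∌*, u, L⟩`. -/
def probBSlalom (u : ℕ → ℕ) (L : ℕ) : MassProblem :=
  {y | (∀ n, y n < u n) ∧ ∀ s : ℕ → ℕ, Computable s → IsSlalomCode u L s →
    ∀ᶠ n in atTop, (s n).testBit (y n) = false}

/-! ### Gamma and Delta values -/

/-- `γ(A)`. -/
noncomputable def gammaVal (A : ℕ → ℕ) : ℝ :=
  sSup ((fun x => lowerDensity (agree A x)) '' {x | IsBitSeq x ∧ Computable x})

/-- `Γ(A)`. -/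
noncomputable def GammaVal (A : ℕ → ℕ) : ℝ :=
  sInf (gammaVal '' {Y | IsBitSeq Y ∧ TuringEquiv Y A})

/-- `δ(A)`. -/
noncomputable def deltaVal (A : ℕ → ℕ) : ℝ :=
  sInf ((fun x => lowerDensity (agree A x)) '' {x | IsBitSeq x ∧ Computable x})

/-- `Δ(A)`. -/
noncomputable def DeltaVal (A : ℕ → ℕ) : ℝ :=
  sSup (deltaVal '' {Y | IsBitSeq Y ∧ TuringLE Y A})

/-! ### Cardinal characteristics -/

/-- The cardinal characteristic `𝔡(p)`. -/
noncomputable def dChar (p : ℝ) : Cardinal :=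
  sInf {c : Cardinal | ∃ G : Set (ℕ → ℕ), c = Cardinal.mk G ∧ (∀ y ∈ G, IsBitSeq y) ∧
    ∀ x : ℕ → ℕ, IsBitSeq x → ∃ y ∈ G, p < lowerDensity (agree x y)}

/-- The cardinal characteristic `𝔟(p)`. -/
noncomputable def bChar (p : ℝ) : Cardinal :=
  sInf {c : Cardinal | ∃ F : Set (ℕ → ℕ), c = Cardinal.mk F ∧ (∀ x ∈ F, IsBitSeq x) ∧
    ∀ y : ℕ → ℕ, IsBitSeq y → ∃ x ∈ F, lowerDensity (agree x y) ≤ p}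

/-- The cardinal characteristic `𝔡(≠*, h)`. -/
noncomputable def dNeq (h : ℕ → ℕ) : Cardinal :=
  sInf {c : Cardinal | ∃ G : Set (ℕ → ℕ), c = Cardinal.mk G ∧ (∀ y ∈ G, ∀ n, y n < h n) ∧
    ∀ x : ℕ → ℕ, ∃ y ∈ G, ∀ᶠ n in atTop, x n ≠ y n}

/-- The cardinal characteristic `𝔟(≠*, h)`. -/
noncomputable def bNeq (h : ℕ → ℕ) : Cardinal :=
  sInf {c : Cardinal | ∃ F : Set (ℕ → ℕ), c = Cardinal.mk F ∧
    ∀ y : ℕ → ℕ, (∀ n, y n < h n) → ∃ x ∈ F, ∃ᶠ n in atTop, x n = y n}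

/-- The cardinal characteristic `𝔡⟨≠*, ĥ, q⟩`. -/
noncomputable def dHam (hh : ℕ → ℕ) (q : ℝ) : Cardinal :=
  sInf {c : Cardinal | ∃ G : Set (ℕ → ℕ), c = Cardinal.mk G ∧
    (∀ y ∈ G, ∀ n, y n < 2 ^ hh n) ∧
    ∀ x : ℕ → ℕ, (∀ n, x n < 2 ^ hh n) →
      ∃ y ∈ G, ∀ᶠ n in atTop, q ≤ nhd (hh n) (x n) (y n)}

/-- The cardinal characteristic `𝔟⟨≠*, ĥ, q⟩`. -/
noncomputable def bHam (hh : ℕ → ℕ) (q : ℝ) : Cardinal :=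
  sInf {c : Cardinal | ∃ F : Set (ℕ → ℕ), c = Cardinal.mk F ∧
    (∀ x ∈ F, ∀ n, x n < 2 ^ hh n) ∧
    ∀ y : ℕ → ℕ, (∀ n, y n < 2 ^ hh n) →
      ∃ x ∈ F, ∃ᶠ n in atTop, nhd (hh n) (x n) (y n) < q}

/-- `s : ℕ → Finset ℕ` is an `L`-slalom bounded by `u`. -/
def IsSlalom (u : ℕ → ℕ) (L : ℕ) (s : ℕ → Finset ℕ) : Prop :=
  ∀ n, (∀ i ∈ s n, i < u n) ∧ (s n).card ≤ L

/-- The cardinal characteristic `𝔡⟨∌*, u, L⟩`. -/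
noncomputable def dSlalom (u : ℕ → ℕ) (L : ℕ) : Cardinal :=
  sInf {c : Cardinal | ∃ G : Set (ℕ → ℕ), c = Cardinal.mk G ∧ (∀ y ∈ G, ∀ n, y n < u n) ∧
    ∀ s : ℕ → Finset ℕ, IsSlalom u L s → ∃ y ∈ G, ∀ᶠ n in atTop, y n ∉ s n}

/-- The cardinal characteristic `𝔟⟨∌*, u, L⟩`. -/
noncomputable def bSlalom (u : ℕ → ℕ) (L : ℕ) : Cardinal :=
  sInf {c : Cardinal | ∃ F : Set (ℕ → Finset ℕ), c = Cardinal.mk F ∧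
    (∀ s ∈ F, IsSlalom u L s) ∧
    ∀ y : ℕ → ℕ, (∀ n, y n < u n) → ∃ s ∈ F, ∃ᶠ n in atTop, y n ∈ s n}

/-! ### Order functions and list decoding -/

/-- An order function: nondecreasing, unbounded and computable. -/
def IsOrderFunc (F : ℕ → ℕ) : Prop :=
  Computable F ∧ Monotone F ∧ ∀ b : ℕ, ∃ n, b < F n

/-- The list-decoding property for parameters `q`, `ε`, `L`: for every length `r`
there is a set `C` of `2^⌊εr⌋` binary strings of length `r` (coded as numbers
below `2^r`) such that every string has at most `L` elements of `C` within
normalized Hamming distance `< q`. -/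
def ListDecoding (q ε : ℝ) (L : ℕ) : Prop :=
  ∀ r : ℕ, ∃ C : Finset ℕ, (∀ a ∈ C, a < 2 ^ r) ∧ C.card = 2 ^ ⌊ε * r⌋₊ ∧
    ∀ σ < 2 ^ r, (C.filter fun τ => nhd r σ τ < q).card ≤ L


/-! ### Computability tools -/

theorem lift_code (c : Nat.Partrec.Code) : ∃ c' : OracleCode, ∀ g, c'.eval g = c.eval := by
  induction c with
  | zero => exact ⟨.zero, fun g => rfl⟩
  | succ => exact ⟨.succ, fun g => rfl⟩
  | left => exact ⟨.left, fun g => rfl⟩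
  | right => exact ⟨.right, fun g => rfl⟩
  | pair a b iha ihb =>
    obtain ⟨a', ha⟩ := iha
    obtain ⟨b', hb⟩ := ihb
    exact ⟨.pair a' b', fun g => by simp only [OracleCode.eval, Nat.Partrec.Code.eval, ha, hb]; rfl⟩
  | comp a b iha ihb =>
    obtain ⟨a', ha⟩ := iha
    obtain ⟨b', hb⟩ := ihb
    exact ⟨.comp a' b', fun g => by simp only [OracleCode.eval, Nat.Partrec.Code.eval, ha, hb]; rfl⟩
  | prec a b iha ihb =>
    obtain ⟨a', ha⟩ := iha
    obtain ⟨b', hb⟩ := ihb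
    exact ⟨.prec a' b', fun g => by simp only [OracleCode.eval, Nat.Partrec.Code.eval, ha, hb]; rfl⟩
  | rfind' a iha =>
    obtain ⟨a', ha⟩ := iha
    exact ⟨.rfind' a', fun g => by simp only [OracleCode.eval, Nat.Partrec.Code.eval, ha]; rfl⟩

theorem code_of_computable {f : ℕ → ℕ} (hf : Computable f) :
    ∃ c : OracleCode, ∀ g n, c.eval g n = Part.some (f n) := by
  have h1 : Nat.Partrec (fun n => Part.some (f n)) := Partrec.nat_iff.1 hf
  obtain ⟨c, hc⟩ := Nat.Partrec.Code.exists_code.1 h1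
  obtain ⟨c', hc'⟩ := lift_code c
  exact ⟨c', fun g n => by rw [hc', hc]⟩

theorem code_one_query {F : ℕ × ℕ → ℕ} {q : ℕ → ℕ} (hF : Computable F) (hq : Computable q) :
    ∃ c : OracleCode, ∀ g n, c.eval g n = Part.some (F (n, g (q n))) := by
  have hF' : Computable (fun n : ℕ => F n.unpair) := hF.comp Computable.unpair
  obtain ⟨cF, hcF⟩ := code_of_computable hF'
  obtain ⟨cq, hcq⟩ := code_of_computable hq
  obtain ⟨ci, hci⟩ := code_of_computable Computable.id
  refine ⟨.comp cF (.pair ci (.comp .oracle cq)), fun g n => ?_⟩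
  have h1 : (OracleCode.comp .oracle cq).eval g n = Part.some (g (q n)) := by
    change Part.bind (cq.eval g n) _ = _
    rw [hcq]
    exact Part.bind_some _ _
  have h2 : (OracleCode.pair ci (.comp .oracle cq)).eval g n
      = Part.some (Nat.pair n (g (q n))) := by
    change Nat.pair <$> (ci.eval g n) <*> (OracleCode.comp .oracle cq).eval g n = _
    rw [h1, hci]
    simp [Seq.seq]
  change Part.bind ((OracleCode.pair ci (.comp .oracle cq)).eval g n) _ = _
  rw [h2]
  refine (Part.bind_some _ _).trans ?_
  rw [hcF]
  simp

/-- Packed prefix of a sequence. -/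
def pack (g : ℕ → ℕ) (n : ℕ) : ℕ := ∑ i ∈ Finset.range n, g i * 2 ^ i

theorem comp_pow : Computable₂ (fun a b : ℕ => a ^ b) :=
  (Primrec₂.unpaired'.1 Nat.Primrec.pow).to_comp

theorem comp_add : Computable₂ (fun a b : ℕ => a + b) := Primrec.nat_add.to_comp
theorem comp_mul : Computable₂ (fun a b : ℕ => a * b) := Primrec.nat_mul.to_comp
theorem comp_sub : Computable₂ (fun a b : ℕ => a - b) := Primrec.nat_sub.to_comp
theorem comp_div : Computable₂ (fun a b : ℕ => a / b) := Primrec.nat_div.to_comp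
theorem comp_mod : Computable₂ (fun a b : ℕ => a % b) := Primrec.nat_mod.to_comp
theorem comp_lt : Computable₂ (fun a b : ℕ => decide (a < b)) :=
  Computable₂.mk (PrimrecPred.decide Primrec.nat_lt).to_comp
theorem comp_eq : Computable₂ (fun a b : ℕ => decide (a = b)) :=
  Computable₂.mk (PrimrecPred.decide Primrec.eq).to_comp
theorem comp_and : Computable₂ (fun a b : Bool => a && b) := Primrec.and.to_comp
theorem comp_or : Computable₂ (fun a b : Bool => a || b) := Primrec.or.to_comp
theorem comp_not : Computable (fun a : Bool => !a) := Primrec.not.to_comp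

theorem code_pack {q : ℕ → ℕ} (hq : Computable q) :
    ∃ c : OracleCode, ∀ g n, c.eval g n = Part.some (pack g (q n)) := by
  have hz : Computable (fun _ : ℕ => 0) := Computable.const 0
  obtain ⟨cz, hcz⟩ := code_of_computable hz
  -- step : ⟨a, ⟨y, i⟩⟩ ↦ i + g y * 2 ^ y
  have hstep : Computable (fun p : ℕ × ℕ => p.1.unpair.2.unpair.2 + p.2 * 2 ^ p.1.unpair.2.unpair.1) := by
    have h2 : Computable (fun p : ℕ × ℕ => p.1.unpair.2.unpair) :=
      Computable.unpair.comp (Computable.snd.comp (Computable.unpair.comp Computable.fst))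
    exact comp_add.comp (Computable.snd.comp h2) (comp_mul.comp Computable.snd
      (comp_pow.comp (Computable.const 2) (Computable.fst.comp h2)))
  have hqq : Computable (fun n : ℕ => n.unpair.2.unpair.1) :=
    Computable.fst.comp (Computable.unpair.comp (Computable.snd.comp Computable.unpair))
  obtain ⟨cs, hcs⟩ := code_one_query hstep hqq
  obtain ⟨cq, hcq⟩ := code_of_computable hq
  refine ⟨.comp (.prec cz cs) (.pair cz cq), fun g n => ?_⟩
  have key : ∀ k, (OracleCode.prec cz cs).eval g (Nat.pair 0 k) = Part.some (pack g k) := by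
    intro k
    induction k with
    | zero => simp [OracleCode.eval, hcz, pack]
    | succ k ih =>
      simp only [OracleCode.eval, Nat.unpaired, Nat.unpair_pair] at ih ⊢
      rw [ih]
      simp [hcs, pack, Finset.sum_range_succ]
  have h0 : (OracleCode.comp (.prec cz cs) (.pair cz cq)).eval g n
      = (OracleCode.pair cz cq).eval g n >>= (OracleCode.prec cz cs).eval g := rfl
  rw [h0]
  have h1 : (OracleCode.pair cz cq).eval g n = Part.some (Nat.pair 0 (q n)) := by
    simp [OracleCode.eval, hcz, hcq, Seq.seq]
  rw [h1]
  exact (Part.bind_some _ _).trans (key (q n))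

theorem comp_find {α : Type*} [Primcodable α] {P : α → ℕ → Bool} (hP : Computable₂ P)
    (hex : ∀ a, ∃ n, P a n = true) : Computable (fun a => Nat.find (hex a)) := by
  have h1 : Partrec fun a => Nat.rfind (fun n => Part.some (P a n)) :=
    Partrec.rfind hP.partrec₂
  refine h1.of_eq_tot fun a => ?_
  refine Nat.mem_rfind.2 ?_
  constructor
  · simpa using (Nat.find_spec (hex a)).symm
  · intro m hm
    have := Nat.find_min (hex a) hm
    simpa using this

theorem comp_sum {α : Type*} [Primcodable α] {F : α → ℕ → ℕ} {k : α → ℕ} (hF : Computable₂ F)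
    (hk : Computable k) : Computable (fun a => ∑ i ∈ Finset.range (k a), F a i) := by
  have h := Computable.nat_rec (f := k) (g := fun _ : α => 0)
    (h := fun a p => p.2 + F a p.1) hk (Computable.const 0)
    (Computable₂.mk (comp_add.comp (Computable.snd.comp Computable.snd)
      (hF.comp Computable.fst (Computable.fst.comp Computable.snd))))
  refine h.of_eq fun a => ?_
  induction k a with
  | zero => simp
  | succ n ih => simp only [Finset.sum_range_succ, ← ih]

/-- `i`-th binary digit. -/
def bit (u i : ℕ) : ℕ := u / 2 ^ i % 2

theorem comp_bit : Computable₂ bit :=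
  comp_mod.comp₂ (comp_div.comp₂ Computable.fst.to₂
    (comp_pow.comp₂ (Computable.const 2).to₂ Computable.snd.to₂)) (Computable.const 2).to₂

theorem bit_lt (u i : ℕ) : bit u i < 2 := Nat.mod_lt _ (by norm_num)

theorem pack_lt {g : ℕ → ℕ} (hg : IsBitSeq g) (n : ℕ) : pack g n < 2 ^ n := by
  induction n with
  | zero => simp [pack]
  | succ n ih =>
    unfold pack at ih ⊢
    rw [Finset.sum_range_succ, pow_succ]
    have := hg n
    have h2 : g n * 2 ^ n ≤ 1 * 2 ^ n := Nat.mul_le_mul_right _ (by omega)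
    omega

theorem bit_pack {g : ℕ → ℕ} (hg : IsBitSeq g) {n i : ℕ} (h : i < n) :
    bit (pack g n) i = g i := by
  have hdec : ∀ k, ∃ t, pack g (i + 1 + k) = pack g (i + 1) + t * 2 ^ (i + 1) := by
    intro k
    induction k with
    | zero => exact ⟨0, by simp⟩
    | succ k ih =>
      obtain ⟨t, ht⟩ := ih
      refine ⟨t + g (i + 1 + k) * 2 ^ k, ?_⟩
      have : pack g (i + 1 + (k + 1)) = pack g (i + 1 + k) + g (i + 1 + k) * 2 ^ (i + 1 + k) := by
        unfold pack
        rw [← add_assoc, Finset.sum_range_succ]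
      rw [this, ht]
      ring
  obtain ⟨k, rfl⟩ := Nat.exists_eq_add_of_le (show i + 1 ≤ n from h)
  obtain ⟨t, ht⟩ := hdec k
  have h1 : pack g (i + 1) = pack g i + g i * 2 ^ i := by
    unfold pack
    rw [Finset.sum_range_succ]
  have h2 := pack_lt hg i
  have h3 := hg i
  unfold bit
  rw [ht, h1]
  have h4 : pack g i + g i * 2 ^ i + t * 2 ^ (i + 1) = pack g i + 2 ^ i * (g i + 2 * t) := by ring
  rw [h4, Nat.add_mul_div_left _ _ (by positivity), Nat.div_eq_of_lt h2]
  omega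

/-! ### Density bookkeeping -/

/-- Number of agreements below `n`. -/
def cnt (x y : ℕ → ℕ) (n : ℕ) : ℕ := ((Finset.range n).filter fun i => x i = y i).card

theorem card_agree (x y : ℕ → ℕ) (n : ℕ) :
    Nat.card ↥(agree x y ∩ Set.Iio n) = cnt x y n := by
  have h : agree x y ∩ Set.Iio n = ((Finset.range n).filter fun i => x i = y i : Finset ℕ) := by
    ext i
    simp [agree, and_comm]
  rw [h, Nat.card_coe_set_eq, Set.ncard_coe_finset]
  rfl

theorem cnt_le (x y : ℕ → ℕ) (n : ℕ) : cnt x y n ≤ n := by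
  simpa [cnt] using Finset.card_filter_le (Finset.range n) (fun i => x i = y i)

theorem lowerDensity_agree (x y : ℕ → ℕ) :
    lowerDensity (agree x y) = Filter.liminf (fun n => (cnt x y n : ℝ) / n) Filter.atTop := by
  unfold lowerDensity
  simp only [card_agree]

theorem ratio_le_one (x y : ℕ → ℕ) (n : ℕ) : (cnt x y n : ℝ) / n ≤ 1 := by
  apply div_le_one_of_le₀
  · exact_mod_cast cnt_le x y n
  · positivity

theorem lowerDensity_le {x y : ℕ → ℕ} {p : ℝ}
    (h : ∃ᶠ n in atTop, (cnt x y n : ℝ) / n ≤ p) : lowerDensity (agree x y) ≤ p := by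
  rw [lowerDensity_agree]
  refine Filter.liminf_le_of_frequently_le h ?_
  exact ⟨0, Filter.eventually_map.2 (Filter.Eventually.of_forall fun n => by positivity)⟩

theorem le_lowerDensity {x y : ℕ → ℕ} {p : ℝ}
    (h : ∀ᶠ n in atTop, p ≤ (cnt x y n : ℝ) / n) : p ≤ lowerDensity (agree x y) := by
  rw [lowerDensity_agree]
  apply Filter.le_liminf_of_le _ h
  apply Filter.IsBoundedUnder.isCoboundedUnder_ge
  exact ⟨1, Filter.eventually_map.2 (Filter.Eventually.of_forall fun n => ratio_le_one x y n)⟩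

/-! ### First direction: `AED ≤ B(p)` -/

theorem aed_le_B (p : ℝ) (hp0 : 0 < p) :
    MedvedevLE (AED fun n => 2 ^ 2 ^ n) (probB p) := by
  have h2 : Computable (fun n : ℕ => 2 ^ n) := comp_pow.comp (Computable.const 2) Computable.id
  obtain ⟨c, hc⟩ := code_pack h2
  refine ⟨c, fun y hy => ⟨fun m => pack y (2 ^ m), ?_, fun n => hc y n⟩⟩
  obtain ⟨hybit, hy⟩ := hy
  refine ⟨fun n => pack_lt hybit _, fun x hx => ?_⟩
  obtain ⟨k0, hk0⟩ := exists_pow_lt_of_lt_one hp0 (show (1 / 2 : ℝ) < 1 by norm_num)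
  obtain ⟨k, hk1, hk⟩ : ∃ k : ℕ, 1 ≤ k ∧ (1 / 2 : ℝ) ^ k ≤ p := by
    refine ⟨k0 + 1, by omega, le_trans ?_ hk0.le⟩
    rw [pow_succ]
    have : (0 : ℝ) < (1 / 2) ^ k0 := by positivity
    linarith
  -- it suffices to treat each residue class
  have main : ∀ j : Fin k, ∀ᶠ n in atTop, pack y (2 ^ (k * n + j)) ≠ x (k * n + j) := by
    intro j
    by_contra hcon
    have hfreq : ∃ᶠ n in atTop, pack y (2 ^ (k * n + j)) = x (k * n + j) := by
      rw [Filter.not_eventually] at hcon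
      simpa using hcon
    have hex : ∀ i : ℕ, ∃ n, decide (i < 2 ^ (k * n)) = true := by
      intro i
      refine ⟨i, ?_⟩
      have : i < 2 ^ i := Nat.lt_two_pow_self
      have h3 : 2 ^ i ≤ 2 ^ (k * i) := Nat.pow_le_pow_right (by norm_num) (Nat.le_mul_of_pos_left _ hk1)
      simpa using lt_of_lt_of_le this h3
    have hPc : Computable₂ (fun i n : ℕ => decide (i < 2 ^ (k * n))) :=
      comp_lt.comp₂ Computable.fst.to₂ (comp_pow.comp₂ (Computable.const 2).to₂
        (comp_mul.comp₂ (Computable.const k).to₂ Computable.snd.to₂))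
    have hfc := comp_find hPc hex
    set lv : ℕ → ℕ := fun i => Nat.find (hex i) with hlv
    let x' : ℕ → ℕ := fun i => 1 - bit (x (k * lv i + j)) i
    have hx' : Computable x' :=
      comp_sub.comp (Computable.const 1) (comp_bit.comp (hx.comp
        (comp_add.comp (comp_mul.comp (Computable.const k) hfc) (Computable.const (j : ℕ))))
        Computable.id)
    have hx'b : IsBitSeq x' := fun n => by
      simp only [x']
      omega
    have hgt := hy x' hx'b hx'
    refine absurd (lowerDensity_le ?_) (not_le.2 hgt)
    -- frequent small ratios
    rw [Filter.frequently_atTop] at hfreq ⊢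
    intro a
    obtain ⟨n, hn, hEq⟩ := hfreq (a + 1)
    refine ⟨2 ^ (k * n), ?_, ?_⟩
    · have h3 : n ≤ k * n := Nat.le_mul_of_pos_left _ hk1
      have h4 : k * n < 2 ^ (k * n) := Nat.lt_two_pow_self
      change a ≤ _
      omega
    · have hcnt : cnt x' y (2 ^ (k * n)) ≤ 2 ^ (k * (n - 1)) := by
        have hsub : ((Finset.range (2 ^ (k * n))).filter fun i => x' i = y i)
            ⊆ Finset.range (2 ^ (k * (n - 1))) := by
          intro i hi
          rw [Finset.mem_filter, Finset.mem_range] at hi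
          rw [Finset.mem_range]
          by_contra hge
          have hlvi : lv i = n := by
            simp only [hlv]
            rw [Nat.find_eq_iff]
            refine ⟨by simpa using hi.1, fun m hm => ?_⟩
            have : 2 ^ (k * m) ≤ 2 ^ (k * (n - 1)) :=
              Nat.pow_le_pow_right (by norm_num) (Nat.mul_le_mul_left _ (by omega))
            simp only [decide_eq_true_eq]
            omega
          have h5 : bit (x (k * lv i + j)) i = y i := by
            rw [hlvi, ← hEq]
            apply bit_pack hybit
            exact lt_of_lt_of_le hi.1 (Nat.pow_le_pow_right (by norm_num) (by omega))
          have h6 := hi.2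
          simp only [x'] at h6
          rw [h5] at h6
          have := hybit i
          omega
        simpa [cnt] using Finset.card_le_card hsub
      refine le_trans ?_ hk
      rw [div_le_iff₀ (by positivity)]
      have h7 : (cnt x' y (2 ^ (k * n)) : ℝ) ≤ 2 ^ (k * (n - 1)) := by exact_mod_cast hcnt
      refine h7.trans (le_of_eq ?_)
      obtain ⟨n', rfl⟩ := Nat.exists_eq_add_of_le' (show 1 ≤ n by omega)
      push_cast
      rw [show k * (n' + 1) = k + k * n' by ring, pow_add, ← mul_assoc,
        ← mul_pow]
      norm_num
  have hall := Filter.eventually_all.2 main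
  rw [Filter.eventually_atTop] at hall ⊢
  obtain ⟨n0, hn0⟩ := hall
  refine ⟨k * (n0 + 1), fun m hm => ?_⟩
  have h8 : n0 ≤ m / k := by
    rw [Nat.le_div_iff_mul_le (by omega)]
    nlinarith
  have h9 := hn0 (m / k) h8 ⟨m % k, Nat.mod_lt _ (by omega)⟩
  simpa [Nat.div_add_mod] using h9

/-! ### An explicit list-decodable code -/

theorem bit_eq_testBit (b t : ℕ) : bit b t = (b.testBit t).toNat := (Nat.toNat_testBit b t).symm

theorem exists_bit_ne {k u u' : ℕ} (hu : u < 2 ^ k) (hu' : u' < 2 ^ k) (hne : u ≠ u') :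
    ∃ t < k, bit u t ≠ bit u' t := by
  by_contra hcon
  push Not at hcon
  apply hne
  apply Nat.eq_of_testBit_eq
  intro i
  by_cases hi : i < k
  · have := hcon i hi
    rw [bit_eq_testBit, bit_eq_testBit] at this
    cases h1 : u.testBit i <;> cases h2 : u'.testBit i <;> simp_all
  · have h3 : 2 ^ k ≤ 2 ^ i := Nat.pow_le_pow_right (by norm_num) (by omega)
    rw [Nat.testBit_lt_two_pow (lt_of_lt_of_le hu h3), Nat.testBit_lt_two_pow (lt_of_lt_of_le hu' h3)]

theorem exists_primes (d : ℕ) : ∃ Q : ℕ → ℕ, Computable Q ∧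
    ∀ m, (Q m).Prime ∧ 2 ^ (m + d) < Q m ∧ Q m ≤ 2 ^ (m + d + 1) := by
  have hfac : Computable (fun n : ℕ => n.factorial) := by
    have h := Computable.nat_rec (f := fun n : ℕ => n) (g := fun _ : ℕ => 1)
      (h := fun (_ : ℕ) (p : ℕ × ℕ) => (p.1 + 1) * p.2) Computable.id (Computable.const 1)
      (Computable₂.mk (comp_mul.comp (comp_add.comp (Computable.fst.comp Computable.snd)
        (Computable.const 1)) (Computable.snd.comp Computable.snd)))
    refine h.of_eq fun a => ?_
    induction a with
    | zero => rfl
    | succ n ih => simp only [Nat.factorial_succ, ← ih]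
  have hprime : ∀ n : ℕ, n ≠ 1 → (n.Prime ↔ ((n - 1).factorial + 1) % n = 0) := by
    intro n hn
    rw [Nat.prime_iff_fac_equiv_neg_one hn, ← Nat.dvd_iff_mod_eq_zero, ← ZMod.natCast_eq_zero_iff]
    push_cast
    rw [eq_neg_iff_add_eq_zero]
  let P : ℕ → ℕ → Bool := fun m n =>
    decide (2 ^ (m + d) < n) && decide (((n - 1).factorial + 1) % n = 0)
  have hP : Computable₂ P := by
    apply comp_and.comp₂
    · exact comp_lt.comp₂ (comp_pow.comp₂ (Computable.const 2).to₂
        (comp_add.comp₂ Computable.fst.to₂ (Computable.const d).to₂)) Computable.snd.to₂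
    · exact comp_eq.comp₂ (comp_mod.comp₂ (comp_add.comp₂ (hfac.comp₂
        (comp_sub.comp₂ Computable.snd.to₂ (Computable.const 1).to₂)) (Computable.const 1).to₂)
        Computable.snd.to₂) (Computable.const 0).to₂
  have hPiff : ∀ m n, P m n = true ↔ 2 ^ (m + d) < n ∧ n.Prime := by
    intro m n
    simp only [P, Bool.and_eq_true, decide_eq_true_eq]
    refine and_congr_right fun h => ?_
    have : 1 ≤ 2 ^ (m + d) := Nat.one_le_two_pow
    exact (hprime n (by omega)).symm
  have hb : ∀ m, ∃ n, P m n = true ∧ n ≤ 2 ^ (m + d + 1) := by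
    intro m
    obtain ⟨n, hn, h1, h2⟩ := Nat.exists_prime_lt_and_le_two_mul (2 ^ (m + d)) (by positivity)
    exact ⟨n, (hPiff m n).2 ⟨h1, hn⟩, by rw [pow_succ]; omega⟩
  have hex : ∀ m, ∃ n, P m n = true := fun m => (hb m).imp fun n h => h.1
  refine ⟨_, comp_find hP hex, fun m => ?_⟩
  have h1 := (hPiff m _).1 (Nat.find_spec (hex m))
  obtain ⟨n, h2, h3⟩ := hb m
  exact ⟨h1.2, h1.1, (Nat.find_min' (hex m) h2).trans h3⟩

/-- Inner product of binary expansions, mod 2. -/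
def ip (s b u : ℕ) : ℕ := (∑ t ∈ Finset.range s, bit b t * bit u t) % 2

/-- Evaluation mod `Q` of the polynomial whose coefficients are the bits of `v`. -/
def ev (Q k v a : ℕ) : ℕ := (∑ j ∈ Finset.range k, bit v j * a ^ j) % Q

/-- The `i`-th bit of the codeword of `v` at level `m`. -/
def W (d : ℕ) (Q : ℕ → ℕ) (m v i : ℕ) : ℕ :=
  ip (m + d + 1) (i % 2 ^ (m + d + 1)) (ev (Q m) (2 ^ m) v (i / 2 ^ (m + d + 1)))

theorem W_lt (d : ℕ) (Q : ℕ → ℕ) (m v i : ℕ) : W d Q m v i < 2 := Nat.mod_lt _ (by norm_num)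

theorem comp_W (d : ℕ) {Q : ℕ → ℕ} (hQ : Computable Q) :
    Computable (fun p : ℕ × ℕ × ℕ => W d Q p.1 p.2.1 p.2.2) := by
  have hm : Computable (fun p : ℕ × ℕ × ℕ => p.1) := Computable.fst
  have hv : Computable (fun p : ℕ × ℕ × ℕ => p.2.1) := Computable.fst.comp Computable.snd
  have hi : Computable (fun p : ℕ × ℕ × ℕ => p.2.2) := Computable.snd.comp Computable.snd
  have hs : Computable (fun p : ℕ × ℕ × ℕ => p.1 + d + 1) :=
    comp_add.comp (comp_add.comp hm (Computable.const d)) (Computable.const 1)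
  have hS : Computable (fun p : ℕ × ℕ × ℕ => 2 ^ (p.1 + d + 1)) :=
    comp_pow.comp (Computable.const 2) hs
  have ha := comp_div.comp hi hS
  have hb := comp_mod.comp hi hS
  have hev : Computable (fun p : ℕ × ℕ × ℕ =>
      ev (Q p.1) (2 ^ p.1) p.2.1 (p.2.2 / 2 ^ (p.1 + d + 1))) := by
    unfold ev
    refine comp_mod.comp (comp_sum (F := fun (p : ℕ × ℕ × ℕ) j =>
      bit p.2.1 j * (p.2.2 / 2 ^ (p.1 + d + 1)) ^ j) ?_
      (comp_pow.comp (Computable.const 2) hm)) (hQ.comp hm)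
    exact Computable₂.mk (comp_mul.comp (comp_bit.comp (hv.comp Computable.fst) Computable.snd)
      (comp_pow.comp (ha.comp Computable.fst) Computable.snd))
  unfold W ip
  refine comp_mod.comp (comp_sum (F := fun (p : ℕ × ℕ × ℕ) t =>
      bit (p.2.2 % 2 ^ (p.1 + d + 1)) t *
        bit (ev (Q p.1) (2 ^ p.1) p.2.1 (p.2.2 / 2 ^ (p.1 + d + 1))) t) ?_ hs) (Computable.const 2)
  exact Computable₂.mk (comp_mul.comp (comp_bit.comp (hb.comp Computable.fst) Computable.snd)
      (comp_bit.comp (hev.comp Computable.fst) Computable.snd))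

theorem had_sum (c : ℕ → ℝ) (s : ℕ) :
    ∑ b ∈ Finset.range (2 ^ s), ∏ t ∈ Finset.range s, c t ^ bit b t
      = ∏ t ∈ Finset.range s, (1 + c t) := by
  induction s with
  | zero => simp
  | succ s ih =>
    rw [pow_succ, mul_two, Finset.sum_range_add, Finset.prod_range_succ, ← ih, mul_add, mul_one,
      Finset.sum_mul]
    congr 1
    · apply Finset.sum_congr rfl
      intro b hb
      rw [Finset.mem_range] at hb
      rw [Finset.prod_range_succ, bit_eq_testBit b s, Nat.testBit_lt_two_pow hb]
      simp
    · apply Finset.sum_congr rfl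
      intro b hb
      rw [Finset.mem_range] at hb
      rw [Finset.prod_range_succ, bit_eq_testBit _ s, Nat.testBit_two_pow_add_eq,
        Nat.testBit_lt_two_pow hb]
      simp only [Bool.not_false, Bool.toNat_true, pow_one]
      congr 1
      apply Finset.prod_congr rfl
      intro t ht
      rw [Finset.mem_range] at ht
      rw [bit_eq_testBit, bit_eq_testBit, Nat.testBit_two_pow_add_gt ht]

theorem had_orth {s u u' : ℕ} (hu : u < 2 ^ s) (hu' : u' < 2 ^ s) (hne : u ≠ u') :
    ∑ b ∈ Finset.range (2 ^ s), (-1 : ℝ) ^ ip s b u * (-1) ^ ip s b u' = 0 := by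
  have h1 : ∀ b u, (-1 : ℝ) ^ ip s b u = ∏ t ∈ Finset.range s, ((-1 : ℝ) ^ bit u t) ^ bit b t := by
    intro b u
    unfold ip
    rw [← neg_one_pow_eq_pow_mod_two, ← Finset.prod_pow_eq_pow_sum]
    apply Finset.prod_congr rfl
    intro t _
    rw [← pow_mul, mul_comm]
  simp only [h1, ← Finset.prod_mul_distrib, ← mul_pow]
  rw [had_sum (fun t => (-1) ^ bit u t * (-1) ^ bit u' t)]
  obtain ⟨t, ht, hbt⟩ := exists_bit_ne hu hu' hne
  apply Finset.prod_eq_zero (Finset.mem_range.2 ht)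
  have h2 := bit_lt u t
  have h3 := bit_lt u' t
  rcases (show bit u t = 0 ∧ bit u' t = 1 ∨ bit u t = 1 ∧ bit u' t = 0 by omega) with h | h <;>
    simp [h.1, h.2]

theorem ev_agree {Q k T v v' : ℕ} (hQ : Q.Prime) (hT : T ≤ Q) (hv : v < 2 ^ k) (hv' : v' < 2 ^ k)
    (hne : v ≠ v') :
    ((Finset.range T).filter fun a => ev Q k v a = ev Q k v' a).card ≤ k := by
  have : Fact Q.Prime := ⟨hQ⟩
  let P : Polynomial (ZMod Q) := ∑ j ∈ Finset.range k,
    Polynomial.monomial j ((bit v j : ZMod Q) - (bit v' j : ZMod Q))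
  have hcoef : ∀ t < k, P.coeff t = (bit v t : ZMod Q) - (bit v' t : ZMod Q) := by
    intro t ht
    simp only [P, Polynomial.finsetSum_coeff, Polynomial.coeff_monomial]
    rw [Finset.sum_ite_eq' (Finset.range k) t]
    simp [ht]
  have hP0 : P ≠ 0 := by
    obtain ⟨t, ht, hbt⟩ := exists_bit_ne hv hv' hne
    intro h0
    have h1 := hcoef t ht
    rw [h0, Polynomial.coeff_zero] at h1
    have h2 := bit_lt v t
    have h3 := bit_lt v' t
    rcases (show bit v t = 0 ∧ bit v' t = 1 ∨ bit v t = 1 ∧ bit v' t = 0 by omega) with h | h <;>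
      simp [h.1, h.2] at h1
  have hdeg : P.natDegree ≤ k := by
    apply Polynomial.natDegree_sum_le_of_forall_le
    intro j hj
    exact (Polynomial.natDegree_monomial_le _).trans (Finset.mem_range.1 hj).le
  have hinj : Set.InjOn (fun a : ℕ => (a : ZMod Q))
      ((Finset.range T).filter fun a => ev Q k v a = ev Q k v' a : Finset ℕ) := by
    intro a ha b hb hab
    simp only [Finset.coe_filter, Finset.mem_range, Set.mem_ofPred_eq] at ha hb
    have := (ZMod.natCast_eq_natCast_iff' a b Q).1 hab
    rwa [Nat.mod_eq_of_lt (by omega), Nat.mod_eq_of_lt (by omega)] at this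
  rw [← Finset.card_image_of_injOn hinj]
  refine (Finset.card_le_card (t := P.roots.toFinset) ?_).trans
    ((Multiset.toFinset_card_le _).trans ((Polynomial.card_roots' P).trans hdeg))
  intro z hz
  obtain ⟨a, ha, rfl⟩ := Finset.mem_image.1 hz
  rw [Multiset.mem_toFinset, Polynomial.mem_roots hP0, Polynomial.IsRoot]
  have h4 := (Finset.mem_filter.1 ha).2
  unfold ev at h4
  have h5 := (ZMod.natCast_eq_natCast_iff' _ _ Q).2 h4
  push_cast at h5
  simp only [P, Polynomial.eval_finsetSum, Polynomial.eval_monomial, sub_mul,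
    Finset.sum_sub_distrib]
  rw [h5, sub_self]

theorem sum_range_blocks (f : ℕ → ℝ) (T n : ℕ) :
    ∑ i ∈ Finset.range (T * n), f i
      = ∑ a ∈ Finset.range T, ∑ b ∈ Finset.range n, f (a * n + b) := by
  induction T with
  | zero => simp
  | succ T ih => rw [add_mul, one_mul, Finset.sum_range_add, ih, Finset.sum_range_succ]

/-- Length of the codewords at level `m`. -/
def rl (d m : ℕ) : ℕ := 2 ^ (m + d) * 2 ^ (m + d + 1)

theorem W_corr {d : ℕ} {Q : ℕ → ℕ} {m v v' : ℕ} (hQ : (Q m).Prime) (hQ1 : 2 ^ (m + d) < Q m)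
    (hQ2 : Q m ≤ 2 ^ (m + d + 1)) (hv : v < 2 ^ 2 ^ m) (hv' : v' < 2 ^ 2 ^ m) (hne : v ≠ v') :
    ∑ i ∈ Finset.range (rl d m), (-1 : ℝ) ^ W d Q m v i * (-1) ^ W d Q m v' i
      ≤ 2 ^ m * 2 ^ (m + d + 1) := by
  unfold rl
  rw [sum_range_blocks]
  set s := m + d + 1 with hs
  have hin : ∀ a, ∑ b ∈ Finset.range (2 ^ s), (-1 : ℝ) ^ W d Q m v (a * 2 ^ s + b)
      * (-1) ^ W d Q m v' (a * 2 ^ s + b)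
      ≤ if ev (Q m) (2 ^ m) v a = ev (Q m) (2 ^ m) v' a then 2 ^ s else 0 := by
    intro a
    have hW : ∀ u, ∀ b ∈ Finset.range (2 ^ s), W d Q m u (a * 2 ^ s + b)
        = ip s b (ev (Q m) (2 ^ m) u a) := by
      intro u b hb
      rw [Finset.mem_range] at hb
      unfold W
      rw [← hs, mul_comm a, Nat.mul_add_mod, Nat.mod_eq_of_lt hb, Nat.mul_add_div (by positivity),
        Nat.div_eq_of_lt hb, add_zero]
    rw [Finset.sum_congr rfl fun b hb => by rw [hW v b hb, hW v' b hb]]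
    split_ifs with h
    · rw [h]
      refine (Finset.sum_le_card_nsmul _ _ 1 ?_).trans (by simp)
      intro b _
      rw [← pow_add, ← two_mul, pow_mul]
      simp
    · apply le_of_eq
      have hlt : ∀ u, ev (Q m) (2 ^ m) u a < 2 ^ s := fun u =>
        lt_of_lt_of_le (Nat.mod_lt _ hQ.pos) hQ2
      exact had_orth (hlt v) (hlt v') h
  refine (Finset.sum_le_sum fun a _ => hin a).trans ?_
  rw [← Finset.sum_filter, Finset.sum_const, nsmul_eq_mul]
  have := ev_agree (T := 2 ^ (m + d)) hQ hQ1.le hv hv' hne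
  gcongr
  exact_mod_cast this

theorem johnson {r : ℕ} (hr : 0 < r) (S : Finset ℕ) (w : ℕ → ℕ → ℝ) (σ : ℕ → ℝ)
    (hw : ∀ v i, w v i * w v i = 1) (hσ : ∀ i, σ i * σ i = 1) {γ η : ℝ} (hγ : 0 < γ)
    (hη : η ≤ γ ^ 2 / 2) (hη0 : 0 ≤ η)
    (hpair : ∀ v ∈ S, ∀ v' ∈ S, v ≠ v' → ∑ i ∈ Finset.range r, w v i * w v' i ≤ η * r)
    (hcor : ∀ v ∈ S, γ * r ≤ - ∑ i ∈ Finset.range r, σ i * w v i) :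
    (S.card : ℝ) ≤ 2 / γ ^ 2 := by
  have hr' : (0 : ℝ) < r := by exact_mod_cast hr
  have h1 : γ * r * S.card ≤ - ∑ i ∈ Finset.range r, σ i * ∑ v ∈ S, w v i := by
    have : ∑ i ∈ Finset.range r, σ i * ∑ v ∈ S, w v i
        = ∑ v ∈ S, ∑ i ∈ Finset.range r, σ i * w v i := by
      simp only [Finset.mul_sum]
      exact Finset.sum_comm
    rw [this, ← Finset.sum_neg_distrib]
    have := Finset.card_nsmul_le_sum S _ _ hcor
    rw [nsmul_eq_mul] at this
    linarith
  have h2 : (∑ i ∈ Finset.range r, σ i * ∑ v ∈ S, w v i) ^ 2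
      ≤ r * ∑ i ∈ Finset.range r, (∑ v ∈ S, w v i) ^ 2 := by
    have := Finset.sum_mul_sq_le_sq_mul_sq (Finset.range r) σ (fun i => ∑ v ∈ S, w v i)
    refine this.trans (le_of_eq ?_)
    congr 1
    simp [pow_two, hσ]
  have h3 : ∑ i ∈ Finset.range r, (∑ v ∈ S, w v i) ^ 2 ≤ S.card * r + S.card ^ 2 * (η * r) := by
    have e1 : ∑ i ∈ Finset.range r, (∑ v ∈ S, w v i) ^ 2
        = ∑ v ∈ S, ∑ v' ∈ S, ∑ i ∈ Finset.range r, w v i * w v' i := by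
      simp only [pow_two, Finset.sum_mul_sum]
      rw [Finset.sum_comm]
      exact Finset.sum_congr rfl fun v _ => Finset.sum_comm
    rw [e1]
    have e2 : ∀ v ∈ S, ∀ v' ∈ S, ∑ i ∈ Finset.range r, w v i * w v' i
        ≤ (if v = v' then (r : ℝ) else 0) + η * r := by
      intro v hv v' hv'
      split_ifs with h
      · subst h
        simp only [hw]
        simp
        positivity
      · simpa using hpair v hv v' hv' h
    refine (Finset.sum_le_sum fun v hv => Finset.sum_le_sum fun v' hv' => e2 v hv v' hv').trans ?_
    apply le_of_eq
    simp [Finset.sum_add_distrib]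
    ring
  have h4 : (γ * r * S.card) ^ 2 ≤ (∑ i ∈ Finset.range r, σ i * ∑ v ∈ S, w v i) ^ 2 := by
    rw [← neg_sq (∑ i ∈ Finset.range r, σ i * ∑ v ∈ S, w v i)]
    exact pow_le_pow_left₀ (by positivity) h1 2
  have h5 : (γ * r * S.card) ^ 2 ≤ r * (S.card * r + S.card ^ 2 * (η * r)) :=
    h4.trans (h2.trans (by gcongr))
  rcases Nat.eq_zero_or_pos S.card with h0 | hpos
  · rw [h0]
    simp
    positivity
  have hc : (0 : ℝ) < S.card := by exact_mod_cast hpos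
  rw [le_div_iff₀ (by positivity)]
  have h6 : (r ^ 2 * S.card : ℝ) * (S.card * γ ^ 2) ≤ (r ^ 2 * S.card) * (1 + S.card * η) := by
    nlinarith
  have h7 := le_of_mul_le_mul_left h6 (by positivity)
  nlinarith

/-- Number of agreements of a codeword with `σ`. -/
def agr (d : ℕ) (Q : ℕ → ℕ) (m v : ℕ) (σ : ℕ → ℕ) : ℕ :=
  ((Finset.range (rl d m)).filter fun i => σ i = W d Q m v i).card

theorem list_decode {qa qb : ℕ} (hq : 2 * qa < qb) : ∃ d L : ℕ, ∀ Q : ℕ → ℕ,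
    (∀ m, (Q m).Prime ∧ 2 ^ (m + d) < Q m ∧ Q m ≤ 2 ^ (m + d + 1)) →
    ∀ m (σ : ℕ → ℕ), IsBitSeq σ →
      ((Finset.range (2 ^ 2 ^ m)).filter fun v => qb * agr d Q m v σ < qa * rl d m).card ≤ L := by
  have hqb : (0 : ℝ) < qb := by exact_mod_cast (by omega : 0 < qb)
  have hq' : 2 * (qa : ℝ) < qb := by exact_mod_cast hq
  set γ : ℝ := 1 - 2 * qa / qb with hγdef
  have hγ : 0 < γ := by
    rw [hγdef, sub_pos, div_lt_one hqb]
    exact hq'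
  obtain ⟨d, hd⟩ := exists_pow_lt_of_lt_one (show 0 < γ ^ 2 / 2 by positivity)
    (show (1 / 2 : ℝ) < 1 by norm_num)
  refine ⟨d, ⌊2 / γ ^ 2⌋₊, fun Q hQ m σ hσ => ?_⟩
  apply Nat.le_floor
  have hrpos : 0 < rl d m := by unfold rl; positivity
  refine johnson hrpos _ (fun v i => (-1) ^ W d Q m v i) (fun i => (-1) ^ σ i) ?_ ?_ hγ hd.le
    (by positivity) ?_ ?_
  · intro v i
    rw [← pow_add, ← two_mul, pow_mul]
    simp
  · intro i
    rw [← pow_add, ← two_mul, pow_mul]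
    simp
  · intro v hv v' hv' hne
    rw [Finset.mem_filter, Finset.mem_range] at hv hv'
    refine (W_corr (hQ m).1 (hQ m).2.1 (hQ m).2.2 hv.1 hv'.1 hne).trans (le_of_eq ?_)
    unfold rl
    push_cast
    rw [pow_add 2 m d, ← mul_assoc, show (1 / 2 : ℝ) ^ d * (2 ^ m * 2 ^ d)
      = (1 / 2 * 2) ^ d * 2 ^ m by rw [mul_pow]; ring]
    norm_num
  · intro v hv
    rw [Finset.mem_filter] at hv
    have h1 : (qb : ℝ) * agr d Q m v σ < qa * rl d m := by exact_mod_cast hv.2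
    have h2 : ∀ i, (-1 : ℝ) ^ σ i * (-1) ^ W d Q m v i
        = 2 * (if σ i = W d Q m v i then 1 else 0) - 1 := by
      intro i
      have a1 := hσ i
      have a2 := W_lt d Q m v i
      generalize W d Q m v i = b at *
      generalize σ i = a at *
      interval_cases a <;> interval_cases b <;> norm_num
    simp only [h2]
    rw [Finset.sum_sub_distrib, ← Finset.mul_sum, Finset.sum_boole]
    have h3 : ((((Finset.range (rl d m)).filter fun i => σ i = W d Q m v i).card : ℕ) : ℝ)
      = agr d Q m v σ := rfl
    rw [h3]
    simp only [Finset.sum_const, Finset.card_range, nsmul_eq_mul, mul_one]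
    have h4 : (agr d Q m v σ : ℝ) ≤ qa / qb * rl d m := by
      rw [div_mul_eq_mul_div, le_div_iff₀ hqb]
      linarith
    rw [hγdef]
    have : (2 * qa / qb : ℝ) = 2 * (qa / qb) := by ring
    rw [this]
    linarith

attribute [irreducible] W

/-! ### Second direction: `B(p) ≤ AED` -/

theorem avoid_slalom {h : ℕ → ℕ} (hh : Computable h) {f : ℕ → ℕ} (hf : f ∈ AED h) (L : ℕ) :
    ∀ B : ℕ → ℕ → Bool, Computable₂ B →
      (∀ m, ((Finset.range (h m)).filter fun v => B m v = true).card ≤ L) →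
      ∀ᶠ m in atTop, B m (f m) = false := by
  induction L with
  | zero =>
    intro B _ hcard
    refine Filter.Eventually.of_forall fun m => ?_
    have h0 := Finset.card_eq_zero.1 (Nat.le_zero.1 (hcard m))
    by_contra hne
    have : f m ∈ (Finset.range (h m)).filter fun v => B m v = true :=
      Finset.mem_filter.2 ⟨Finset.mem_range.2 (hf.1 m), by simpa using hne⟩
    rw [h0] at this
    simp at this
  | succ L ih =>
    intro B hB hcard
    have hex : ∀ m, ∃ v, (B m v || decide (v = h m)) = true := fun m => ⟨h m, by simp⟩
    have hPc : Computable₂ (fun m v => (B m v || decide (v = h m))) :=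
      comp_or.comp₂ hB (comp_eq.comp₂ Computable.snd.to₂ (hh.comp Computable.fst).to₂)
    have he := comp_find hPc hex
    set e : ℕ → ℕ := fun m => Nat.find (hex m) with hedef
    have h1 := hf.2 e he
    have hB' : Computable₂ (fun m v => B m v && !(decide (v = e m))) :=
      comp_and.comp₂ hB (comp_not.comp₂ (comp_eq.comp₂ Computable.snd.to₂
        (he.comp Computable.fst).to₂))
    have h2 := ih _ hB' (fun m => by
      have hsub : ((Finset.range (h m)).filter fun v => (B m v && !(decide (v = e m))) = true)
          ⊆ ((Finset.range (h m)).filter fun v => B m v = true).erase (e m) := by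
        intro v hv
        simp only [Finset.mem_filter, Finset.mem_erase, Bool.and_eq_true, Bool.not_eq_true',
          decide_eq_false_iff_not] at hv ⊢
        exact ⟨hv.2.2, hv.1, hv.2.1⟩
      refine (Finset.card_le_card hsub).trans ?_
      by_cases hmem : e m ∈ (Finset.range (h m)).filter fun v => B m v = true
      · rw [Finset.card_erase_of_mem hmem]
        have := hcard m
        omega
      · have hempty : ((Finset.range (h m)).filter fun v => B m v = true) = ∅ := by
          rw [Finset.eq_empty_iff_forall_notMem]
          intro v hv
          apply hmem
          rw [Finset.mem_filter, Finset.mem_range] at hv ⊢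
          have hle : e m ≤ v := Nat.find_min' (hex m) (by simp [hv.2])
          have hlt : e m < h m := by omega
          have hsp := Nat.find_spec (hex m)
          change (B m (e m) || decide (e m = h m)) = true at hsp
          refine ⟨hlt, ?_⟩
          simpa [hlt.ne] using hsp
        rw [hempty]
        simp)
    filter_upwards [h1, h2] with m hm1 hm2
    simpa [hm1] using hm2

theorem rl_eq (d m : ℕ) : rl d m = 4 ^ m * rl d 0 := by
  unfold rl
  rw [show (4 : ℕ) = 2 ^ 2 by norm_num, ← pow_mul]
  simp only [← pow_add]
  congr 1
  omega

theorem rl_succ (d m : ℕ) : rl d (m + 1) = 4 * rl d m := by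
  rw [rl_eq d (m + 1), rl_eq d m, pow_succ]
  ring

theorem rl_pos (d m : ℕ) : 0 < rl d m := by unfold rl; positivity

theorem rl_mono (d : ℕ) : Monotone (rl d) :=
  monotone_nat_of_le_succ fun m => by rw [rl_succ]; omega

theorem comp_rl (d : ℕ) : Computable (rl d) := by
  have h2 : ∀ e, Computable (fun m : ℕ => 2 ^ (m + e)) := fun e =>
    comp_pow.comp (Computable.const 2) (comp_add.comp Computable.id (Computable.const e))
  exact comp_mul.comp (h2 d) (h2 (d + 1))

theorem exists_level (d M : ℕ) (hM : 1 ≤ M) : ∃ lv : ℕ → ℕ, Computable lv ∧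
    (∀ i, i < M * rl d (lv i + 1)) ∧ (∀ i, M * rl d 0 ≤ i → M * rl d (lv i) ≤ i) := by
  have hex : ∀ i : ℕ, ∃ m, decide (i < M * rl d (m + 1)) = true := by
    intro i
    refine ⟨i, ?_⟩
    rw [decide_eq_true_eq]
    have h1 : i < 2 ^ i := Nat.lt_two_pow_self
    have h2 : 2 ^ i ≤ 2 ^ (i + 1 + d) := Nat.pow_le_pow_right (by norm_num) (by omega)
    have h3 : 2 ^ (i + 1 + d) ≤ rl d (i + 1) := by
      unfold rl
      exact Nat.le_mul_of_pos_right _ (by positivity)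
    have h4 : rl d (i + 1) ≤ M * rl d (i + 1) := Nat.le_mul_of_pos_left _ hM
    omega
  have hPc : Computable₂ (fun i m : ℕ => decide (i < M * rl d (m + 1))) :=
    comp_lt.comp₂ Computable.fst.to₂ (comp_mul.comp₂ (Computable.const M).to₂
      ((comp_rl d).comp₂ (comp_add.comp₂ Computable.snd.to₂ (Computable.const 1).to₂)))
  refine ⟨_, comp_find hPc hex, fun i => ?_, fun i hi => ?_⟩
  · simpa using Nat.find_spec (hex i)
  · rcases hz : Nat.find (hex i) with _ | k
    · simpa using hi
    · have := Nat.find_min (hex i) (m := k) (by omega)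
      simpa using this


theorem cnt_add (x y : ℕ → ℕ) (a b : ℕ) : cnt x y (a + b) = cnt x y a +
    ((Finset.range b).filter fun i => x (a + i) = y (a + i)).card := by
  unfold cnt
  simp only [Finset.card_filter]
  rw [Finset.sum_range_add]

theorem cnt_mono (x y : ℕ → ℕ) : Monotone (cnt x y) := by
  intro a b hab
  obtain ⟨c, rfl⟩ := Nat.exists_eq_add_of_le hab
  rw [cnt_add]
  omega

theorem level_unique {d M : ℕ} {lv : ℕ → ℕ} (h1 : ∀ i, i < M * rl d (lv i + 1))
    (h2 : ∀ i, M * rl d 0 ≤ i → M * rl d (lv i) ≤ i) {i m : ℕ}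
    (hlo : M * rl d m ≤ i) (hhi : i < M * rl d (m + 1)) : lv i = m := by
  have h3 := h1 i
  have h4 := h2 i ((Nat.mul_le_mul_left _ (rl_mono d (Nat.zero_le m))).trans hlo)
  rcases lt_trichotomy (lv i) m with h | h | h
  · have := Nat.mul_le_mul_left M (rl_mono d (show lv i + 1 ≤ m by omega))
    omega
  · exact h
  · have := Nat.mul_le_mul_left M (rl_mono d (show m + 1 ≤ lv i by omega))
    omega

theorem comp_bad (d : ℕ) {Q x : ℕ → ℕ} (hQ : Computable Q) (hx : Computable x) (c qa qb : ℕ) :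
    Computable₂ (fun m v => decide (qb * agr d Q m v (fun o => x (rl d m * c + o))
      < qa * rl d m)) := by
  have hm : Computable (fun p : ℕ × ℕ => rl d p.1) := (comp_rl d).comp Computable.fst
  have hagr : Computable (fun p : ℕ × ℕ => agr d Q p.1 p.2 (fun o => x (rl d p.1 * c + o))) := by
    unfold agr
    simp only [Finset.card_filter]
    refine comp_sum (F := fun (p : ℕ × ℕ) i =>
      if x (rl d p.1 * c + i) = W d Q p.1 p.2 i then 1 else 0) ?_ hm
    have hW : Computable (fun p : (ℕ × ℕ) × ℕ => W d Q p.1.1 p.1.2 p.2) :=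
      (comp_W d hQ).comp (Computable.pair (Computable.fst.comp Computable.fst)
        (Computable.pair (Computable.snd.comp Computable.fst) Computable.snd))
    have hX : Computable (fun p : (ℕ × ℕ) × ℕ => x (rl d p.1.1 * c + p.2)) :=
      hx.comp (comp_add.comp (comp_mul.comp (hm.comp Computable.fst)
        (Computable.const c)) Computable.snd)
    have hc : Computable (fun p : (ℕ × ℕ) × ℕ =>
        decide (x (rl d p.1.1 * c + p.2) = W d Q p.1.1 p.1.2 p.2)) := by
      exact comp_eq.comp hX hW
    refine (Computable.cond hc (Computable.const 1) (Computable.const 0)).of_eq fun p => ?_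
    simp only [Bool.cond_decide]
  exact Computable₂.mk (comp_lt.comp (comp_mul.comp (Computable.const qb) hagr)
    (comp_mul.comp (Computable.const qa) hm))

theorem B_le_aed (p : ℝ) (hp0 : 0 < p) (hp1 : p < 1 / 2) :
    MedvedevLE (probB p) (AED fun n => 2 ^ 2 ^ n) := by
  -- a rational between p and 1/2
  obtain ⟨qa, qb, hq, hpq⟩ : ∃ qa qb : ℕ, 2 * qa < qb ∧ p < (qa : ℝ) / qb := by
    obtain ⟨q, h1, h2⟩ := exists_rat_btwn hp1
    have hq0 : 0 < q := by exact_mod_cast hp0.trans h1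
    have hnum : 0 < q.num := Rat.num_pos.2 hq0
    have hcast : (q : ℝ) = (q.num.toNat : ℝ) / q.den := by
      have e1 : ((q.num.toNat : ℤ) : ℝ) = (q.num : ℝ) := by rw [Int.toNat_of_nonneg hnum.le]
      have e2 := Rat.cast_def (K := ℝ) q
      rw [e2, ← e1, Int.cast_natCast]
    refine ⟨q.num.toNat, q.den, ?_, hcast ▸ h1⟩
    rw [hcast, div_lt_iff₀ (by exact_mod_cast q.den_pos)] at h2
    have : (2 * (q.num.toNat : ℝ)) < q.den := by linarith
    exact_mod_cast this
  set q : ℝ := (qa : ℝ) / qb with hqdef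
  have hqb : (0 : ℝ) < qb := by exact_mod_cast (by omega : 0 < qb)
  have hq1 : q < 1 := by
    rw [hqdef, div_lt_one hqb]
    exact_mod_cast (by omega : qa < qb)
  obtain ⟨M, hM⟩ := exists_nat_gt (4 / (q - p))
  have hqp : 0 < q - p := sub_pos.2 hpq
  have hMpos : (0 : ℝ) < M := lt_trans (by positivity) hM
  have hM1 : 1 ≤ M := by exact_mod_cast hMpos
  obtain ⟨d, L, hlist⟩ := list_decode hq
  obtain ⟨Q, hQc, hQ⟩ := exists_primes d
  obtain ⟨lv, hlvc, hlv1, hlv2⟩ := exists_level d M hM1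
  have hF : Computable (fun z : ℕ × ℕ => W d Q (lv z.1) z.2 (z.1 % rl d (lv z.1))) :=
    (comp_W d hQc).comp (Computable.pair (hlvc.comp Computable.fst) (Computable.pair Computable.snd
      (comp_mod.comp Computable.fst ((comp_rl d).comp (hlvc.comp Computable.fst)))))
  obtain ⟨code, hcode⟩ := code_one_query hF hlvc
  refine ⟨code, fun f hf => ⟨fun n => W d Q (lv n) (f (lv n)) (n % rl d (lv n)), ?_,
    fun n => hcode f n⟩⟩
  set y : ℕ → ℕ := fun n => W d Q (lv n) (f (lv n)) (n % rl d (lv n)) with hy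
  refine ⟨fun n => W_lt _ _ _ _ _, fun x hxb hxc => ?_⟩
  -- eventually no block is bad
  have hh : Computable (fun n : ℕ => 2 ^ 2 ^ n) := comp_pow.comp (Computable.const 2)
    (comp_pow.comp (Computable.const 2) Computable.id)
  have hev : ∀ᶠ m in atTop, ∀ c : Fin (4 * M),
      qa * rl d m ≤ qb * agr d Q m (f m) (fun o => x (rl d m * c + o)) := by
    rw [Filter.eventually_all]
    intro c
    have h1 := avoid_slalom hh hf L _ (comp_bad d hQc hxc c qa qb) (fun m => by
      simpa using hlist Q hQ m (fun o => x (rl d m * c + o)) (fun o => hxb _))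
    filter_upwards [h1] with m hm
    simpa using hm
  obtain ⟨m0, hm0⟩ := Filter.eventually_atTop.1 hev
  -- one block
  have hblock : ∀ m c, M ≤ c → c < 4 * M → cnt x y (rl d m * c + rl d m)
      = cnt x y (rl d m * c) + agr d Q m (f m) (fun o => x (rl d m * c + o)) := by
    intro m c hc1 hc2
    rw [cnt_add]
    congr 1
    unfold agr
    congr 1
    apply Finset.filter_congr
    intro o ho
    rw [Finset.mem_range] at ho
    have hl : lv (rl d m * c + o) = m := by
      apply level_unique hlv1 hlv2
      · rw [mul_comm]
        exact (Nat.mul_le_mul_left _ hc1).trans (Nat.le_add_right _ _)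
      · rw [rl_succ]
        have : rl d m * (c + 1) ≤ rl d m * (4 * M) := Nat.mul_le_mul_left _ hc2
        calc rl d m * c + o < rl d m * (c + 1) := by rw [mul_add]; omega
          _ ≤ rl d m * (4 * M) := this
          _ = M * (4 * rl d m) := by ring
    have hyo : y (rl d m * c + o) = W d Q m (f m) o := by
      simp only [hy]
      rw [hl, Nat.mul_add_mod, Nat.mod_eq_of_lt ho]
    rw [hyo]
  have hcum : ∀ m, m0 ≤ m → ∀ c, M ≤ c → c ≤ 4 * M →
      qa * (rl d m * c) ≤ qb * cnt x y (rl d m * c) + qa * (rl d m0 * M) := by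
    have hinner : ∀ m, m0 ≤ m →
        qa * (rl d m * M) ≤ qb * cnt x y (rl d m * M) + qa * (rl d m0 * M) →
        ∀ c, M ≤ c → c ≤ 4 * M →
          qa * (rl d m * c) ≤ qb * cnt x y (rl d m * c) + qa * (rl d m0 * M) := by
      intro m hm hbase c hc
      induction c, hc using Nat.le_induction with
      | base => exact fun _ => hbase
      | succ c hc ih =>
        intro hc4
        have h1 := ih (by omega)
        have h2 := hm0 m hm ⟨c, by omega⟩
        simp only at h2
        rw [mul_add (rl d m), mul_one, hblock m c hc (by omega), mul_add, mul_add]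
        omega
    intro m hm
    induction m, hm using Nat.le_induction with
    | base => exact hinner m0 le_rfl (Nat.le_add_left _ _)
    | succ m hm ih =>
      apply hinner (m + 1) (by omega)
      have := ih (4 * M) (by omega) le_rfl
      rw [rl_succ, show 4 * rl d m * M = rl d m * (4 * M) by ring]
      exact this
  -- conclusion
  refine lt_of_lt_of_le (show p < (p + q) / 2 by linarith) (le_lowerDensity ?_)
  rw [Filter.eventually_atTop]
  refine ⟨M * (rl d m0 * M) + 1, fun n hn => ?_⟩
  set K0 := rl d m0 * M with hK0
  have hnK : K0 ≤ n := by
    have : K0 ≤ M * K0 := Nat.le_mul_of_pos_left _ hM1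
    omega
  have hbase : M * rl d 0 ≤ n := by
    have := Nat.mul_le_mul_left M (rl_mono d (Nat.zero_le m0))
    rw [mul_comm M (rl d m0)] at this
    omega
  have hl1 := hlv1 n
  have hl2 := hlv2 n hbase
  set m := lv n with hmdef
  have hmm : m0 ≤ m := by
    by_contra hlt
    have := Nat.mul_le_mul_left M (rl_mono d (show m + 1 ≤ m0 by omega))
    rw [mul_comm M (rl d m0)] at this
    omega
  have hr := rl_pos d m
  have hc1 : M ≤ n / rl d m := (Nat.le_div_iff_mul_le hr).2 hl2
  have hc2 : n / rl d m < 4 * M := by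
    rw [Nat.div_lt_iff_lt_mul hr]
    rw [rl_succ] at hl1
    calc n < M * (4 * rl d m) := hl1
      _ = 4 * M * rl d m := by ring
  have h5 := hcum m hmm _ hc1 hc2.le
  have h6 : rl d m * (n / rl d m) ≤ n := Nat.mul_div_le n _
  have h7 : n < rl d m * (n / rl d m) + rl d m := by
    have := Nat.lt_mul_div_succ n hr
    rw [mul_add, mul_one] at this
    exact this
  have h8 := cnt_mono x y h6
  have h9 : qa * n ≤ qb * cnt x y n + qa * K0 + qa * rl d m := by
    have a1 : qa * n ≤ qa * (rl d m * (n / rl d m)) + qa * rl d m := by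
      rw [← mul_add]
      exact Nat.mul_le_mul_left _ h7.le
    have a2 := Nat.mul_le_mul_left qb h8
    omega
  have hn0 : (0 : ℝ) < n := by exact_mod_cast (by omega : 0 < n)
  have r1 : (K0 : ℝ) ≤ n / M := by
    rw [le_div_iff₀ hMpos]
    have : K0 * M ≤ n := by rw [mul_comm]; omega
    exact_mod_cast this
  have r2 : (rl d m : ℝ) ≤ n / M := by
    rw [le_div_iff₀ hMpos]
    have : rl d m * M ≤ n := by rw [mul_comm]; exact hl2
    exact_mod_cast this
  have h9' : (qa : ℝ) * n ≤ qb * cnt x y n + qa * K0 + qa * rl d m := by exact_mod_cast h9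
  have hqa : (qa : ℝ) = q * qb := by rw [hqdef]; field_simp
  rw [hqa] at h9'
  have h10 : q * n ≤ cnt x y n + q * K0 + q * rl d m := by
    have : qb * (q * n) ≤ qb * (cnt x y n + q * K0 + q * rl d m) := by linarith
    exact le_of_mul_le_mul_left this hqb
  have hq0 : 0 < q := hp0.trans hpq
  have r3 : q * K0 ≤ n / M := by
    have : q * K0 ≤ 1 * K0 := by gcongr
    linarith
  have r4 : q * rl d m ≤ n / M := by
    have : q * rl d m ≤ 1 * rl d m := by gcongr
    linarith
  have r5 : (n : ℝ) / M ≤ (q - p) / 4 * n := by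
    rw [div_lt_iff₀ hqp] at hM
    rw [div_le_iff₀ hMpos]
    nlinarith
  rw [le_div_iff₀ hn0]
  linarith

/-- For every real `p` with `0 < p < 1/2`, the mass problem `B(p)` is Medvedev
equivalent to `AED(n ↦ 2^(2^n))`. -/
theorem stmt1 (p : ℝ) (hp0 : 0 < p) (hp1 : p < 1 / 2) :
    MedvedevLE (probB p) (AED fun n => 2 ^ 2 ^ n) ∧
      MedvedevLE (AED fun n => 2 ^ 2 ^ n) (probB p) := by
  exact ⟨B_le_aed p hp0 hp1, aed_le_B p hp0⟩

end Paper
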